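/- High wavenumber refinement: there exist constants c_t > 0 and c_n > 0 such that for all ε ∈ (0,1) and all k ∈ ℤ with k ≠ 0: c_t^{−1} ε|k| ≤ m_ε^t(k)^{−1} ≤ c_t^{−1}(ε|k| + 1) and c_n^{−1} ε|k| ≤ m_ε^n(k)^{−1} ≤ c_n^{−1}(ε|k| + 1). -/

import Mathlib

open scoped Real BigOperators
open MeasureTheory

noncomputable section

namespace Filament

/-- ℝ³. -/
abbrev V : Type := EuclideanSpace ℝ (Fin 3)
/-- ℂ³. -/
abbrev VC : Type := EuclideanSpace ℂ (Fin 3)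

/-- Fourier coefficient `ℱ[h](k) = ∫_𝕋 h(s) e^{2πiks} ds` of a (1-periodic) complex valued
function on the unit torus, viewed as a function on `ℝ`. -/
def fc (h : ℝ → ℂ) (k : ℤ) : ℂ :=
  ∫ s in (0:ℝ)..1, h s * Complex.exp (2 * (Real.pi : ℂ) * Complex.I * (k : ℂ) * (s : ℂ))

/-- Componentwise Fourier coefficient of an ℝ³-valued function. -/
def fcV (h : ℝ → V) (k : ℤ) : VC :=
  (WithLp.equiv 2 (Fin 3 → ℂ)).symm (fun i => fc (fun s => ((h s i : ℝ) : ℂ)) k)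

/-- Fourier coefficient of a real scalar function. -/
def fcR (h : ℝ → ℝ) (k : ℤ) : ℂ := fc (fun s => ((h s : ℝ) : ℂ)) k

/-- Squared inhomogeneous Sobolev norm `‖h‖_{H^σ}²`. -/
def HsqV (σ : ℝ) (h : ℝ → V) : ℝ := ∑' k : ℤ, (1 + (k:ℝ)^2) ^ σ * ‖fcV h k‖^2

/-- Sobolev norm `‖h‖_{H^σ}`. -/
def HnV (σ : ℝ) (h : ℝ → V) : ℝ := Real.sqrt (HsqV σ h)

/-- Squared inhomogeneous Sobolev norm of a scalar function. -/
def HsqR (σ : ℝ) (h : ℝ → ℝ) : ℝ := ∑' k : ℤ, (1 + (k:ℝ)^2) ^ σ * ‖fcR h k‖^2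

/-- Sobolev norm of a scalar function. -/
def HnR (σ : ℝ) (h : ℝ → ℝ) : ℝ := Real.sqrt (HsqR σ h)

/-- Squared homogeneous Sobolev seminorm `‖h‖_{Ḣ^σ}²` (the `k = 0` mode is omitted). -/
def HdotsqV (σ : ℝ) (h : ℝ → V) : ℝ :=
  ∑' k : {k : ℤ // k ≠ 0}, (|((k : ℤ) : ℝ)|) ^ (2*σ) * ‖fcV h k‖^2

/-- Homogeneous Sobolev seminorm `‖h‖_{Ḣ^σ}`. -/
def HdotV (σ : ℝ) (h : ℝ → V) : ℝ := Real.sqrt (HdotsqV σ h)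

/-- Membership `h ∈ H^σ(𝕋; ℝ³)`. -/
def MemHV (σ : ℝ) (h : ℝ → V) : Prop :=
  Summable (fun k : ℤ => (1 + (k:ℝ)^2) ^ σ * ‖fcV h k‖^2)

/-- Membership `h ∈ H^σ(𝕋; ℝ)`. -/
def MemHR (σ : ℝ) (h : ℝ → ℝ) : Prop :=
  Summable (fun k : ℤ => (1 + (k:ℝ)^2) ^ σ * ‖fcR h k‖^2)

/-- Modified Bessel function of the second kind of (integer) order `j`:
`K_j(x) = ∫₀^∞ e^{−x cosh t} cosh (j t) dt`. -/
def besselK (j : ℕ) (x : ℝ) : ℝ :=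
  ∫ t in Set.Ioi (0:ℝ), Real.exp (-x * Real.cosh t) * Real.cosh ((j : ℝ) * t)

/-- `|log ε|` for `0 < ε < 1`. -/
def logn (ε : ℝ) : ℝ := -Real.log ε

/-- The tangential slender body multiplier `m_ε^t`. -/
def mt (ε : ℝ) : ℤ → ℝ := fun k =>
  if k = 0 then logn ε / (2 * Real.pi) else
    let x := 2 * Real.pi * ε * |(k : ℝ)|
    let K0 := besselK 0 x
    let K1 := besselK 1 x
    (2*K0*K1 + x * (K0^2 - K1^2)) / (8 * Real.pi^2 * ε * |(k:ℝ)| * K1^2)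

/-- The normal slender body multiplier `m_ε^n`. -/
def mn (ε : ℝ) : ℤ → ℝ := fun k =>
  if k = 0 then logn ε / (4 * Real.pi) else
    let x := 2 * Real.pi * ε * |(k : ℝ)|
    let K0 := besselK 0 x
    let K1 := besselK 1 x
    let K2 := besselK 2 x
    (2*K0*K1*K2 + x * (K1^2*(K0+K2) - 2*K0^2*K2))
      / (4 * Real.pi^2 * ε * |(k:ℝ)| * (4*K1^2*K2 + x * K1 * (K1^2 - K0*K2)))

/-- Fourier multiplier operator with symbol `m`, on complex scalar functions:
`(T_m h)(s) = Σ_k m(k) ℱ[h](k) e^{−2πiks}`. -/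
def TmC (m : ℤ → ℝ) (h : ℝ → ℂ) : ℝ → ℂ :=
  fun s => ∑' k : ℤ, (m k : ℂ) * fc h k *
    Complex.exp (-(2 * (Real.pi : ℂ) * Complex.I * (k : ℂ) * (s : ℂ)))

/-- Fourier multiplier operator with (real) symbol `m` acting componentwise on ℝ³-valued
functions. -/
def Tm (m : ℤ → ℝ) (h : ℝ → V) : ℝ → V :=
  fun s => (WithLp.equiv 2 (Fin 3 → ℝ)).symm
    (fun i => (TmC m (fun t => ((h t i : ℝ) : ℂ)) s).re)

/-- Euclidean dot product on ℝ³. -/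
def dotV (x y : V) : ℝ := ∑ i, x i * y i

/-- `a · conj b` for `a b : ℂ³`. -/
def fdot (a b : VC) : ℂ := ∑ i, a i * (starRingEnd ℂ) (b i)

/-- Tangential projection `P_{u} h = (u·h) u` (with `u = X_s`). -/
def Ptan (u h : ℝ → V) : ℝ → V := fun s => dotV (u s) (h s) • u s

/-- Normal projection `P⊥_{u} h = h − (u·h) u`. -/
def Pperp (u h : ℝ → V) : ℝ → V := fun s => h s - Ptan u h s

/-- The force-to-velocity map `ℒ̄_ε` along a curve with unit tangent `u = X_s`. -/
def Leps (ε : ℝ) (u f : ℝ → V) : ℝ → V :=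
  fun s => Ptan u (Tm (mt ε) (Ptan u f)) s + Pperp u (Tm (mn ε) (Pperp u f)) s

/-- A (1-periodic) curve of Sobolev regularity `σ` parametrized by arclength:
`X ∈ H^σ(𝕋;ℝ³)` with `|X_s| = 1` a.e. -/
structure IsCurve (σ : ℝ) (X : ℝ → V) : Prop where
  periodic : Function.Periodic X 1
  mem : MemHV σ X
  unit : ∀ᵐ s : ℝ, ‖deriv X s‖ = 1

/-- The tangential part `(X_s · X_ssss) X_s` of `X_ssss`. -/
def tangential4 (X : ℝ → V) : ℝ → V :=
  fun s => dotV (deriv X s) (iteratedDeriv 4 X s) • deriv X s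

/-- `τ` is a weak solution of the tension equation
`(ℒ̄_ε[(τX_s)_s])_s·X_s = (ℒ̄_ε[X_ssss])_s·X_s`. -/
def WeakTension (ε : ℝ) (X : ℝ → V) (τ : ℝ → ℝ) : Prop :=
  ∀ φ : ℝ → ℝ, Function.Periodic φ 1 → MemHR 1 φ →
    (∑' k : ℤ,
      ((mt ε k : ℂ) * fdot (fcV (fun s => deriv φ s • deriv X s) k)
          (fcV (fun s => deriv τ s • deriv X s) k)
        + (mn ε k : ℂ) * fdot (fcV (fun s => φ s • iteratedDeriv 2 X s) k)
          (fcV (fun s => τ s • iteratedDeriv 2 X s) k)))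
    = ∑' k : ℤ,
      ((mt ε k : ℂ) * fdot (fcV (fun s => deriv φ s • deriv X s) k) (fcV (tangential4 X) k)
        + (mn ε k : ℂ) * fdot (fcV (fun s => φ s • iteratedDeriv 2 X s) k)
          (fcV (Pperp (deriv X) (iteratedDeriv 4 X)) k))

/-- The remainder `R[X] = ℒ̄_ε[∂_s⁴X] − T_{m_ε^n}(∂_s⁴X)`. -/
def Rop (ε : ℝ) (X : ℝ → V) : ℝ → V :=
  fun s => Leps ε (deriv X) (iteratedDeriv 4 X) s - Tm (mn ε) (iteratedDeriv 4 X) s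

/-- `ℒ̄_ε[(τ X_s)_s] = P_{X_s} T_{m_ε^t}(τ_s X_s) + P⊥_{X_s} T_{m_ε^n}(τ X_ss)`. -/
def tensionForce (ε : ℝ) (X : ℝ → V) (τ : ℝ → ℝ) : ℝ → V :=
  fun s => Ptan (deriv X) (Tm (mt ε) (fun r => deriv τ r • deriv X r)) s
         + Pperp (deriv X) (Tm (mn ε) (fun r => τ r • iteratedDeriv 2 X r)) s

/-- The symbol `λ_k = m_ε^n(k) (2πk)⁴` of `A = T_{m_ε^n} ∂_s⁴`. -/
def lamb (ε : ℝ) (k : ℤ) : ℝ := mn ε k * (2 * Real.pi * (k:ℝ))^4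

/-- The semigroup `e^{−t a A}`, i.e. the multiplier with symbol `e^{−a λ_k t}`
(`a` is a time-rescaling factor; `a = 1` is the unrescaled evolution). -/
def heat (ε a t : ℝ) (h : ℝ → V) : ℝ → V :=
  Tm (fun k => Real.exp (-(a * lamb ε k) * t)) h

/-- `X` is a solution on `[0,T]` of the (time-rescaled by `a`) filament evolution
`∂ₜX = −a ℒ̄_ε[(X_sss − τX_s)_s]`, `|X_s|² = 1`, with initial data `X0` and tension field `τ`,
in the mild (Duhamel) formulation, belonging to `C([0,T];H²) ∩ L²([0,T];H^{7/2})`. -/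
structure IsSolutionOn (ε a T : ℝ) (X0 : ℝ → V) (X : ℝ → ℝ → V) (τ : ℝ → ℝ → ℝ) : Prop where
  curve : ∀ t ∈ Set.Icc (0:ℝ) T, IsCurve 2 (X t)
  contH2 : ∀ t ∈ Set.Icc (0:ℝ) T, ∀ δ > (0:ℝ), ∃ η > (0:ℝ), ∀ t' ∈ Set.Icc (0:ℝ) T,
      |t' - t| < η → HnV 2 (fun s => X t' s - X t s) < δ
  l2H : IntegrableOn (fun t => HsqV (7/2) (X t)) (Set.Icc 0 T)
  init : X 0 = X0
  tension : ∀ᵐ r ∂(volume.restrict (Set.Icc (0:ℝ) T)),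
      Function.Periodic (τ r) 1 ∧ MemHR (1/2) (τ r) ∧ WeakTension ε (X r) (τ r)
  duhamel : ∀ t ∈ Set.Icc (0:ℝ) T, ∀ s : ℝ,
      X t s = heat ε a t X0 s
        + ∫ r in (0:ℝ)..t,
            (heat ε a (t - r)
              (fun y => a • (tensionForce ε (X r) (τ r) y - Rop ε (X r) y))) s

/-- `(I + u ⊗ u) w`. -/
def rftApply (u w : ℝ → V) : ℝ → V := fun s => w s + dotV (u s) (w s) • u s

/-- `Y` is a solution on `[0,T]` of the time-rescaled resistive force theory evolution
`∂ₜY = −(1/(4π))(I + Y_s⊗Y_s)(Y_sss − τ_Y Y_s)_s`, `|Y_s| = 1`, with initial data `X0` and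
RFT tension `τY`, belonging to `C([0,T];H⁴) ∩ L²([0,T];H⁶)`. -/
structure IsRFTSolutionOn (T : ℝ) (X0 : ℝ → V) (Y : ℝ → ℝ → V) (τY : ℝ → ℝ → ℝ) : Prop where
  curve : ∀ t ∈ Set.Icc (0:ℝ) T, Function.Periodic (Y t) 1 ∧ MemHV 4 (Y t) ∧
      (∀ᵐ s : ℝ, ‖deriv (Y t) s‖ = 1)
  contH4 : ∀ t ∈ Set.Icc (0:ℝ) T, ∀ δ > (0:ℝ), ∃ η > (0:ℝ), ∀ t' ∈ Set.Icc (0:ℝ) T,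
      |t' - t| < η → HnV 4 (fun s => Y t' s - Y t s) < δ
  l2H : IntegrableOn (fun t => HsqV 6 (Y t)) (Set.Icc 0 T)
  init : Y 0 = X0
  tension : ∀ t ∈ Set.Icc (0:ℝ) T, Function.Periodic (τY t) 1 ∧ MemHR 1 (τY t) ∧
      ∀ s : ℝ,
        dotV (deriv (rftApply (deriv (Y t))
            (fun x => deriv (fun y => τY t y • deriv (Y t) y) x)) s) (deriv (Y t) s)
        = dotV (deriv (rftApply (deriv (Y t)) (iteratedDeriv 4 (Y t))) s) (deriv (Y t) s)
  evol : ∀ t ∈ Set.Icc (0:ℝ) T, ∀ s : ℝ,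
      HasDerivAt (fun r => Y r s)
        (-((1/(4*Real.pi)) • rftApply (deriv (Y t))
            (fun x => deriv (fun y => iteratedDeriv 3 (Y t) y - τY t y • deriv (Y t) y) x) s)) t


/-- The moment `∫₀^∞ e^{-x cosh t} (cosh t)^n dt`; for `n = 0, 1` this is `K_n(x)`. -/
def coshMoment (n : ℕ) (x : ℝ) : ℝ :=
  ∫ t in Set.Ioi (0:ℝ), Real.exp (-x * Real.cosh t) * Real.cosh t ^ n

lemma exp_neg_mul_cosh_mul_pow_le (n : ℕ) {x t : ℝ} (hx : 0 < x) (ht : 0 ≤ t) :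
    Real.exp (-x * Real.cosh t) * Real.cosh t ^ n
      ≤ Real.exp (((n:ℝ) + 1) ^ 2 / (2 * x)) * Real.exp (-t) := by
  have hcosh : Real.cosh t ≤ Real.exp t := by
    rw [Real.cosh_eq]
    have : Real.exp (-t) ≤ Real.exp t := Real.exp_le_exp.2 (by linarith)
    linarith
  have hquad : t ^ 2 / 2 ≤ Real.cosh t := by
    have hs : t / 2 ≤ Real.sinh (t / 2) := Real.self_le_sinh_iff.2 (by positivity)
    have hc : Real.cosh t = 1 + 2 * Real.sinh (t / 2) ^ 2 := by
      have h := Real.cosh_two_mul (t / 2)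
      rw [mul_div_cancel₀ t two_ne_zero, Real.cosh_sq] at h
      linarith
    nlinarith
  have hpow : Real.cosh t ^ n ≤ Real.exp (n * t) := by
    rw [Real.exp_nat_mul]
    exact pow_le_pow_left₀ (Real.cosh_pos t).le hcosh n
  calc Real.exp (-x * Real.cosh t) * Real.cosh t ^ n
      ≤ Real.exp (-x * (t ^ 2 / 2)) * Real.exp (n * t) := by
        gcongr ?_ * ?_
        exact Real.exp_le_exp.2 (by nlinarith)
    _ ≤ _ := by
        rw [← Real.exp_add, ← Real.exp_add]
        apply Real.exp_le_exp.2
        have : ((n:ℝ) + 1) ^ 2 / (2 * x) + -t - (-x * (t ^ 2 / 2) + n * t)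
            = (x * t - (n + 1)) ^ 2 / (2 * x) := by
          field_simp
          ring
        have h0 : 0 ≤ (x * t - (n + 1)) ^ 2 / (2 * x) := by positivity
        linarith

lemma integrableOn_exp_neg_mul_cosh_mul_pow (n : ℕ) {x : ℝ} (hx : 0 < x) :
    IntegrableOn (fun t => Real.exp (-x * Real.cosh t) * Real.cosh t ^ n) (Set.Ioi 0) := by
  refine Integrable.mono' (g := fun t => Real.exp (((n:ℝ) + 1) ^ 2 / (2 * x)) * Real.exp (-t))
    ((integrableOn_exp_neg_Ioi 0).const_mul _) (by fun_prop) ?_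
  filter_upwards [ae_restrict_mem measurableSet_Ioi] with t ht
  rw [Real.norm_of_nonneg (mul_nonneg (Real.exp_pos _).le (pow_nonneg (Real.cosh_pos t).le n))]
  exact exp_neg_mul_cosh_mul_pow_le n hx (le_of_lt ht)

lemma coshMoment_pos (n : ℕ) {x : ℝ} (hx : 0 < x) : 0 < coshMoment n x := by
  have hpos : ∀ t : ℝ, 0 < Real.exp (-x * Real.cosh t) * Real.cosh t ^ n :=
    fun t => mul_pos (Real.exp_pos _) (pow_pos (Real.cosh_pos t) n)
  rw [coshMoment, setIntegral_pos_iff_support_of_nonneg_ae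
    (Filter.Eventually.of_forall fun t => (hpos t).le) (integrableOn_exp_neg_mul_cosh_mul_pow n hx)]
  rw [Function.support_eq_univ fun t => (hpos t).ne']
  simp

lemma coshMoment_zero_le_one {x : ℝ} (hx : 0 < x) : coshMoment 0 x ≤ coshMoment 1 x := by
  refine setIntegral_mono (integrableOn_exp_neg_mul_cosh_mul_pow 0 hx)
    (integrableOn_exp_neg_mul_cosh_mul_pow 1 hx) fun t => ?_
  simpa using le_mul_of_one_le_right (Real.exp_pos (-(x * Real.cosh t))).le (Real.one_le_cosh t)

lemma hasDerivAt_coshMoment (n : ℕ) {x : ℝ} (hx : 0 < x) :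
    HasDerivAt (coshMoment n) (-coshMoment (n + 1) x) x := by
  have h := hasDerivAt_integral_of_dominated_loc_of_deriv_le
    (μ := volume.restrict (Set.Ioi (0:ℝ))) (s := Set.Ioi (x / 2)) (x₀ := x)
    (F := fun y t => Real.exp (-y * Real.cosh t) * Real.cosh t ^ n)
    (F' := fun y t => -(Real.exp (-y * Real.cosh t) * Real.cosh t ^ (n + 1)))
    (bound := fun t => Real.exp (-(x / 2) * Real.cosh t) * Real.cosh t ^ (n + 1))
    (Ioi_mem_nhds (by linarith))
    (Filter.Eventually.of_forall fun y => by fun_prop)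
    (integrableOn_exp_neg_mul_cosh_mul_pow n hx) (by fun_prop)
    (Filter.Eventually.of_forall fun t y hy => ?_)
    (integrableOn_exp_neg_mul_cosh_mul_pow (n + 1) (half_pos hx))
    (Filter.Eventually.of_forall fun t y hy => ?_)
  · have h2 := h.2
    rw [integral_neg] at h2
    exact h2
  · have hc := Real.cosh_pos t
    rw [norm_neg, Real.norm_of_nonneg (by positivity)]
    have hy' : x / 2 < y := hy
    gcongr
  · have h1 : HasDerivAt (fun y : ℝ => -y * Real.cosh t) (-1 * Real.cosh t) y :=
      ((hasDerivAt_id y).neg).mul_const _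
    exact (h1.exp.mul_const (Real.cosh t ^ n)).congr_deriv (by ring)

lemma mul_coshMoment_two {x : ℝ} (hx : 0 < x) :
    x * coshMoment 2 x = x * coshMoment 0 x + coshMoment 1 x := by
  have hderiv : ∀ t ∈ Set.Ici (0:ℝ), HasDerivAt
      (fun t => Real.exp (-x * Real.cosh t) * Real.sinh t)
      (Real.exp (-x * Real.cosh t) * Real.cosh t ^ 1
        - x * (Real.exp (-x * Real.cosh t) * Real.cosh t ^ 2
          - Real.exp (-x * Real.cosh t) * Real.cosh t ^ 0)) t := fun t _ => by
    refine ((((Real.hasDerivAt_cosh t).const_mul (-x)).exp).mul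
      (Real.hasDerivAt_sinh t)).congr_deriv ?_
    linear_combination (x * Real.exp (-x * Real.cosh t)) * Real.cosh_sq t
  have hI := fun n => integrableOn_exp_neg_mul_cosh_mul_pow n hx
  have hI02 : IntegrableOn (fun t => Real.exp (-x * Real.cosh t) * Real.cosh t ^ 2
      - Real.exp (-x * Real.cosh t) * Real.cosh t ^ 0) (Set.Ioi 0) := (hI 2).sub (hI 0)
  have htend : Filter.Tendsto (fun t => Real.exp (-x * Real.cosh t) * Real.sinh t)
      Filter.atTop (nhds 0) := by
    have hbound : Filter.Tendsto
        (fun t => Real.exp ((((1:ℕ):ℝ) + 1) ^ 2 / (2 * x)) * Real.exp (-t))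
        Filter.atTop (nhds 0) := by
      simpa using (Real.tendsto_exp_neg_atTop_nhds_zero).const_mul
        (Real.exp ((((1:ℕ):ℝ) + 1) ^ 2 / (2 * x)))
    refine tendsto_of_tendsto_of_tendsto_of_le_of_le' tendsto_const_nhds hbound ?_ ?_
    · filter_upwards [Filter.eventually_ge_atTop 0] with t ht
      exact mul_nonneg (Real.exp_pos _).le (Real.sinh_nonneg_iff.2 ht)
    · filter_upwards [Filter.eventually_ge_atTop 0] with t ht
      refine le_trans ?_ (exp_neg_mul_cosh_mul_pow_le 1 hx ht)
      rw [pow_one]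
      exact mul_le_mul_of_nonneg_left (Real.sinh_lt_cosh t).le (Real.exp_pos _).le
  have h := integral_Ioi_of_hasDerivAt_of_tendsto' hderiv
    ((hI 1).sub (hI02.const_mul x)) htend
  rw [integral_sub (hI 1) (hI02.const_mul x), integral_const_mul,
    integral_sub (hI 2) (hI 0)] at h
  simp only [Real.sinh_zero, mul_zero, sub_zero] at h
  simp only [coshMoment]
  linarith

lemma coshMoment_le_exp_mul (n : ℕ) {x : ℝ} (hx : 1 ≤ x) :
    coshMoment n x ≤ Real.exp (-(x - 1)) * coshMoment n 1 := by
  rw [coshMoment, coshMoment, ← integral_const_mul]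
  refine setIntegral_mono (integrableOn_exp_neg_mul_cosh_mul_pow n (by linarith))
    ((integrableOn_exp_neg_mul_cosh_mul_pow n one_pos).const_mul _) fun t => ?_
  have hc := Real.one_le_cosh t
  simp only
  rw [← mul_assoc, ← Real.exp_add]
  gcongr
  nlinarith

lemma tendsto_coshMoment_atTop (n : ℕ) :
    Filter.Tendsto (coshMoment n) Filter.atTop (nhds 0) := by
  have hbound : Filter.Tendsto (fun x : ℝ => Real.exp (-(x - 1)) * coshMoment n 1)
      Filter.atTop (nhds 0) := by
    have := (Real.tendsto_exp_neg_atTop_nhds_zero.comp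
      (Filter.tendsto_atTop_add_const_right Filter.atTop (-1 : ℝ) Filter.tendsto_id)).mul_const
      (coshMoment n 1)
    simpa [Function.comp_def, sub_eq_add_neg] using this
  refine tendsto_of_tendsto_of_tendsto_of_le_of_le' tendsto_const_nhds hbound ?_ ?_
  · filter_upwards [Filter.eventually_gt_atTop 0] with x hx
    exact (coshMoment_pos n hx).le
  · filter_upwards [Filter.eventually_ge_atTop 1] with x hx
    exact coshMoment_le_exp_mul n hx

/-- A function on `(0, ∞)` whose derivative is positive wherever it is positive cannot be positive
if it is dominated by a function vanishing at infinity. -/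
lemma nonpos_of_deriv_pos_of_le_tendsto_zero {G G' B : ℝ → ℝ}
    (hG : ∀ x, 0 < x → HasDerivAt G (G' x) x) (hpos : ∀ x, 0 < x → 0 < G x → 0 < G' x)
    (hle : ∀ x, 0 < x → G x ≤ B x) (hB : Filter.Tendsto B Filter.atTop (nhds 0))
    {x : ℝ} (hx : 0 < x) : G x ≤ 0 := by
  by_contra! h
  have hlow : ∀ y, x ≤ y → G x ≤ G y := fun y hy =>
    image_le_of_deriv_right_lt_deriv_boundary' (f := fun _ => G x) (f' := fun _ => 0)
      (B := G) (B' := G') (a := x) (b := y) continuousOn_const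
      (fun z _ => hasDerivWithinAt_const _ _ _) le_rfl
      (fun z hz => (hG z (hx.trans_le hz.1)).continuousAt.continuousWithinAt)
      (fun z hz => (hG z (hx.trans_le hz.1)).hasDerivWithinAt)
      (fun z hz hz' => hpos z (hx.trans_le hz.1) (hz' ▸ h)) ⟨hy, le_rfl⟩
  have hev : ∀ᶠ y in Filter.atTop, G x ≤ B y := by
    filter_upwards [Filter.eventually_ge_atTop x] with y hy
    exact (hlow y hy).trans (hle y (hx.trans_le hy))
  exact absurd (ge_of_tendsto hB hev) (not_le.2 h)

lemma hasDerivAt_coshMoment_one {x : ℝ} (hx : 0 < x) :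
    HasDerivAt (coshMoment 1) (-(coshMoment 0 x + coshMoment 1 x / x)) x := by
  convert hasDerivAt_coshMoment 1 hx using 2
  have := mul_coshMoment_two hx
  field_simp
  linarith

/-- A positive subsolution of the Riccati equation `r' = r² + r / x - 1` bounds `K₀ / K₁` from
above. -/
lemma coshMoment_zero_le_of_subsolution {ρ ρ' : ℝ → ℝ}
    (hρ : ∀ x, 0 < x → HasDerivAt ρ (ρ' x) x) (hpos : ∀ x, 0 < x → 0 < ρ x)
    (hsub : ∀ x, 0 < x → ρ' x ≤ ρ x ^ 2 + ρ x / x - 1) {x : ℝ} (hx : 0 < x) :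
    coshMoment 0 x ≤ ρ x * coshMoment 1 x := by
  have key := nonpos_of_deriv_pos_of_le_tendsto_zero
    (G := fun y => coshMoment 0 y - ρ y * coshMoment 1 y) (B := coshMoment 0)
    (fun y hy => (hasDerivAt_coshMoment 0 hy).sub ((hρ y hy).mul (hasDerivAt_coshMoment_one hy)))
    (fun y hy hG => ?_) (fun y hy => ?_) (tendsto_coshMoment_atTop 0) hx
  · simpa using key
  · have h1 := mul_pos (hpos y hy) hG
    have h2 := mul_nonneg (sub_nonneg.2 (hsub y hy)) (coshMoment_pos 1 hy).le
    have h3 : ρ y * (coshMoment 1 y / y) = ρ y / y * coshMoment 1 y := by ring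
    simp only [zero_add]
    nlinarith
  · have := mul_pos (hpos y hy) (coshMoment_pos 1 hy)
    linarith

/-- A positive supersolution of the Riccati equation `r' = r² + r / x - 1`, at most `1`, bounds
`K₀ / K₁` from below. -/
lemma le_coshMoment_zero_of_supersolution {ρ ρ' : ℝ → ℝ}
    (hρ : ∀ x, 0 < x → HasDerivAt ρ (ρ' x) x) (hpos : ∀ x, 0 < x → 0 < ρ x)
    (hle : ∀ x, 0 < x → ρ x ≤ 1)
    (hsuper : ∀ x, 0 < x → ρ x ^ 2 + ρ x / x - 1 ≤ ρ' x) {x : ℝ} (hx : 0 < x) :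
    ρ x * coshMoment 1 x ≤ coshMoment 0 x := by
  have key := nonpos_of_deriv_pos_of_le_tendsto_zero
    (G := fun y => ρ y * coshMoment 1 y - coshMoment 0 y) (B := coshMoment 1)
    (fun y hy => ((hρ y hy).mul (hasDerivAt_coshMoment_one hy)).sub (hasDerivAt_coshMoment 0 hy))
    (fun y hy hG => ?_) (fun y hy => ?_) (tendsto_coshMoment_atTop 1) hx
  · simpa using key
  · have h1 := mul_pos (hpos y hy) hG
    have h2 := mul_nonneg (sub_nonneg.2 (hsuper y hy)) (coshMoment_pos 1 hy).le
    have h3 : ρ y * (coshMoment 1 y / y) = ρ y / y * coshMoment 1 y := by ring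
    simp only [zero_add]
    nlinarith
  · have h1 := mul_le_mul_of_nonneg_right (hle y hy) (coshMoment_pos 1 hy).le
    have h2 := coshMoment_pos 0 hy
    linarith

lemma two_mul_div_mul_coshMoment_one_le {x : ℝ} (hx : 0 < x) :
    2 * x / (2 * x + 1) * coshMoment 1 x ≤ coshMoment 0 x := by
  refine le_coshMoment_zero_of_supersolution (ρ := fun y => 2 * y / (2 * y + 1))
    (ρ' := fun y => 2 / (2 * y + 1) ^ 2) (fun y hy => ?_) (fun y hy => by positivity)
    (fun y hy => ?_) (fun y hy => ?_) hx
  · have h1 : HasDerivAt (fun y : ℝ => 2 * y) (2 * 1) y := (hasDerivAt_id y).const_mul 2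
    exact (h1.div (h1.add_const 1) (by positivity)).congr_deriv (by ring)
  · rw [div_le_one (by positivity)]
    linarith
  · have : (2 * y / (2 * y + 1)) ^ 2 + 2 * y / (2 * y + 1) / y - 1 = 1 / (2 * y + 1) ^ 2 := by
      field_simp
      ring
    rw [this]
    gcongr
    norm_num

lemma coshMoment_zero_le_sqrt_mul {x : ℝ} (hx : 0 < x) :
    coshMoment 0 x ≤ (Real.sqrt (x ^ 2 + x + 1) - 1) / x * coshMoment 1 x := by
  have hsq : ∀ y : ℝ, 0 < y → Real.sqrt (y ^ 2 + y + 1) ^ 2 = y ^ 2 + y + 1 :=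
    fun y hy => Real.sq_sqrt (by positivity)
  refine coshMoment_zero_le_of_subsolution (ρ := fun y => (Real.sqrt (y ^ 2 + y + 1) - 1) / y)
    (ρ' := fun y => ((2 * y + 1) / (2 * Real.sqrt (y ^ 2 + y + 1)) * y
      - (Real.sqrt (y ^ 2 + y + 1) - 1) * 1) / y ^ 2)
    (fun y hy => ?_) (fun y hy => ?_) (fun y hy => ?_) hx
  · have h1 : HasDerivAt (fun y : ℝ => y ^ 2 + y + 1) (2 * y + 1) y := by
      simpa using ((hasDerivAt_pow 2 y).add (hasDerivAt_id y)).add_const 1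
    exact ((h1.sqrt (by positivity)).sub_const 1).div (hasDerivAt_id y) hy.ne'
  · apply div_pos _ hy
    rw [sub_pos, Real.lt_sqrt zero_le_one]
    nlinarith
  · have hs := hsq y hy
    have hspos : 0 < Real.sqrt (y ^ 2 + y + 1) := Real.sqrt_pos.2 (by positivity)
    have hslope : (2 * y + 1) / (2 * Real.sqrt (y ^ 2 + y + 1)) ≤ 1 := by
      rw [div_le_one (by positivity)]
      have : y + 1 / 2 ≤ Real.sqrt (y ^ 2 + y + 1) := Real.le_sqrt_of_sq_le (by nlinarith)
      linarith
    set s := Real.sqrt (y ^ 2 + y + 1)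
    have h1 : ((s - 1) / y) ^ 2 + (s - 1) / y / y - 1 = ((s - 1) ^ 2 + (s - 1) - y ^ 2) / y ^ 2 := by
      field_simp
    rw [h1]
    refine div_le_div_of_nonneg_right ?_ (by positivity)
    nlinarith

/-- The two bounds on `r = K₀ / K₁` from which all multiplier estimates follow. -/
lemma coshMoment_ratio_bounds {x : ℝ} (hx : 0 < x) :
    2 * x ≤ coshMoment 0 x / coshMoment 1 x * (2 * x + 1) ∧
      2 * (coshMoment 0 x / coshMoment 1 x) + x * (coshMoment 0 x / coshMoment 1 x) ^ 2 ≤ x + 1 := by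
  have h1 := coshMoment_pos 1 hx
  have hlow : 2 * x / (2 * x + 1) ≤ coshMoment 0 x / coshMoment 1 x :=
    (le_div_iff₀ h1).2 (two_mul_div_mul_coshMoment_one_le hx)
  have hup : coshMoment 0 x / coshMoment 1 x ≤ (Real.sqrt (x ^ 2 + x + 1) - 1) / x :=
    (div_le_iff₀ h1).2 (coshMoment_zero_le_sqrt_mul hx)
  have hr : 0 < coshMoment 0 x / coshMoment 1 x := div_pos (coshMoment_pos 0 hx) h1
  set r := coshMoment 0 x / coshMoment 1 x
  refine ⟨(div_le_iff₀ (by positivity)).1 hlow, ?_⟩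
  rw [le_div_iff₀ hx] at hup
  have hs : Real.sqrt (x ^ 2 + x + 1) ^ 2 = x ^ 2 + x + 1 := Real.sq_sqrt (by positivity)
  have h2 : (r * x + 1) ^ 2 ≤ x ^ 2 + x + 1 := by
    rw [← hs]
    exact pow_le_pow_left₀ (by positivity) (by linarith) 2
  have h3 : x * (2 * r + x * r ^ 2) ≤ x * (x + 1) := by nlinarith
  exact le_of_mul_le_mul_left h3 hx

lemma besselK_zero (x : ℝ) : besselK 0 x = coshMoment 0 x := by
  simp [besselK, coshMoment]

lemma besselK_one (x : ℝ) : besselK 1 x = coshMoment 1 x := by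
  simp [besselK, coshMoment]

lemma besselK_two {x : ℝ} (hx : 0 < x) :
    besselK 2 x = coshMoment 0 x + 2 * coshMoment 1 x / x := by
  have h : besselK 2 x = 2 * coshMoment 2 x - coshMoment 0 x := by
    rw [besselK, coshMoment, coshMoment, ← integral_const_mul, ← integral_sub
      ((integrableOn_exp_neg_mul_cosh_mul_pow 2 hx).const_mul 2)
      (integrableOn_exp_neg_mul_cosh_mul_pow 0 hx)]
    congr 1
    funext t
    have := Real.cosh_sq t
    push_cast
    rw [Real.cosh_two_mul, pow_zero]
    linear_combination (-Real.exp (-x * Real.cosh t)) * this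
  have h2 := mul_coshMoment_two hx
  rw [h]
  field_simp
  linarith

lemma inv_mt_eq {ε : ℝ} (hε : 0 < ε) {k : ℤ} (hk : k ≠ 0) {x r : ℝ}
    (hx : x = 2 * Real.pi * (ε * |(k:ℝ)|)) (hr : r = coshMoment 0 x / coshMoment 1 x) :
    (mt ε k)⁻¹ = 4 * Real.pi * (x / (2 * r + x * (r ^ 2 - 1))) := by
  have hk' : 0 < |(k:ℝ)| := abs_pos.2 (by exact_mod_cast hk)
  have hx0 : 0 < x := by rw [hx]; positivity
  have h1 := coshMoment_pos 1 hx0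
  have hx' : 2 * Real.pi * ε * |(k:ℝ)| = x := by rw [hx]; ring
  have hx2 : 8 * Real.pi ^ 2 * ε * |(k:ℝ)| = 4 * Real.pi * x := by rw [hx]; ring
  have h0 : coshMoment 0 x = r * coshMoment 1 x := by rw [hr]; field_simp
  simp only [mt, if_neg hk, hx', hx2, besselK_zero, besselK_one, h0, inv_div]
  rw [show 2 * (r * coshMoment 1 x) * coshMoment 1 x
      + x * ((r * coshMoment 1 x) ^ 2 - coshMoment 1 x ^ 2)
      = (2 * r + x * (r ^ 2 - 1)) * coshMoment 1 x ^ 2 by ring,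
    mul_div_mul_right _ _ (by positivity), mul_div_assoc]

lemma inv_mn_eq {ε : ℝ} (hε : 0 < ε) {k : ℤ} (hk : k ≠ 0) {x r D : ℝ}
    (hx : x = 2 * Real.pi * (ε * |(k:ℝ)|)) (hr : r = coshMoment 0 x / coshMoment 1 x)
    (hD : D = 2 * r + x * (r ^ 2 - 1)) :
    (mn ε k)⁻¹ = 2 * Real.pi * (x * (4 * r + 8 / x - D)
      / (2 + 4 * r / x + 2 * r ^ 2 - 2 * r * D)) := by
  have hk' : 0 < |(k:ℝ)| := abs_pos.2 (by exact_mod_cast hk)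
  have hx0 : 0 < x := by rw [hx]; positivity
  have h1 := coshMoment_pos 1 hx0
  have hx' : 2 * Real.pi * ε * |(k:ℝ)| = x := by rw [hx]; ring
  have hx2 : 4 * Real.pi ^ 2 * ε * |(k:ℝ)| = 2 * Real.pi * x := by rw [hx]; ring
  have h0 : coshMoment 0 x = r * coshMoment 1 x := by rw [hr]; field_simp
  simp only [mn, if_neg hk, hx', hx2, besselK_zero, besselK_one, besselK_two hx0, h0, inv_div]
  set K := coshMoment 1 x
  rw [show 2 * (r * K) * K * (r * K + 2 * K / x)
      + x * (K ^ 2 * (r * K + (r * K + 2 * K / x)) - 2 * (r * K) ^ 2 * (r * K + 2 * K / x))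
      = (2 + 4 * r / x + 2 * r ^ 2 - 2 * r * D) * K ^ 3 by rw [hD]; field_simp; ring,
    show 2 * Real.pi * x * (4 * K ^ 2 * (r * K + 2 * K / x)
      + x * K * (K ^ 2 - r * K * (r * K + 2 * K / x)))
      = 2 * Real.pi * (x * (4 * r + 8 / x - D)) * K ^ 3 by rw [hD]; field_simp; ring,
    mul_div_mul_right _ _ (by positivity), mul_div_assoc]

/-- Lower bound on the tangential symbol in terms of the ratio `r = K₀ / K₁`. -/
lemma le_tangential_symbol {x r : ℝ} (hx : 0 < x) (hlow : 2 * x ≤ r * (2 * x + 1)) :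
    x * (4 * x + 3) / (2 * x + 1) ^ 2 ≤ 2 * r + x * (r ^ 2 - 1) := by
  have hl : 2 * x / (2 * x + 1) ≤ r := (div_le_iff₀ (by positivity)).2 hlow
  have heq : x * (4 * x + 3) / (2 * x + 1) ^ 2
      = 2 * (2 * x / (2 * x + 1)) + x * ((2 * x / (2 * x + 1)) ^ 2 - 1) := by
    field_simp
    ring
  rw [heq]
  gcongr

lemma normal_symbol_bounds {x r D : ℝ} (hx : 0 < x) (hr0 : 0 < r) (hr1 : r ≤ 1)
    (hlow : 2 * x ≤ r * (2 * x + 1)) (hD : x * (4 * x + 3) / (2 * x + 1) ^ 2 ≤ D) (hD1 : D ≤ 1) :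
    3 / 2 * x ≤ x * (4 * r + 8 / x - D) / (2 + 4 * r / x + 2 * r ^ 2 - 2 * r * D) ∧
      x * (4 * r + 8 / x - D) / (2 + 4 * r / x + 2 * r ^ 2 - 2 * r * D) ≤ 3 / 2 * (x + 6) := by
  have hrx : 0 < r / x := div_pos hr0 hx
  have hrD : r * D ≤ r := mul_le_of_le_one_right hr0.le hD1
  have hN0 : 2 - 2 * r + 2 * r ^ 2 + 4 * (r / x) ≤ 2 + 4 * r / x + 2 * r ^ 2 - 2 * r * D := by
    rw [mul_div_assoc]
    linarith
  have hN : 0 < 2 + 4 * r / x + 2 * r ^ 2 - 2 * r * D := by nlinarith [sq_nonneg (r - 1 / 2)]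
  rw [le_div_iff₀ hN, div_le_iff₀ hN]
  have hdef : 1 - D ≤ (x + 1) / (2 * x + 1) ^ 2 := by
    have : 1 - x * (4 * x + 3) / (2 * x + 1) ^ 2 = (x + 1) / (2 * x + 1) ^ 2 := by
      field_simp
      ring
    linarith
  constructor
  · have h1r : 1 - r ≤ 1 / (2 * x + 1) := by
      rw [le_div_iff₀ (by positivity)]
      linarith
    have h1 : (1 - D) * (6 * r - 2) ≤ 4 * ((x + 1) / (2 * x + 1) ^ 2) := by nlinarith
    have h2 : 4 * ((x + 1) / (2 * x + 1) ^ 2) ≤ 4 / x - 2 * (1 / (2 * x + 1)) := by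
      rw [← sub_nonneg]
      have : 4 / x - 2 * (1 / (2 * x + 1)) - 4 * ((x + 1) / (2 * x + 1) ^ 2)
          = (8 * x ^ 2 + 10 * x + 4) / (x * (2 * x + 1) ^ 2) := by
        field_simp
        ring
      rw [this]
      positivity
    have h3 : 4 / x - 2 * (1 / (2 * x + 1)) ≤ (4 - 3 * r) * (4 / x - 2 * (1 - r)) := by
      have h4 : 0 ≤ 4 / x - 2 * (1 - r) := by
        have : 0 ≤ 4 * ((x + 1) / (2 * x + 1) ^ 2) := by positivity
        linarith
      nlinarith
    have h4 : 0 ≤ 2 * (4 * r + 8 / x - D) - 3 * (2 + 4 * r / x + 2 * r ^ 2 - 2 * r * D) := by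
      have : 2 * (4 * r + 8 / x - D) - 3 * (2 + 4 * r / x + 2 * r ^ 2 - 2 * r * D)
          = (4 - 3 * r) * (4 / x - 2 * (1 - r)) - (1 - D) * (6 * r - 2) := by
        field_simp
        ring
      linarith
    nlinarith
  · have hxD : 2 * x - 1 ≤ 2 * (x * D) := by
      have h1 : 2 * (x * (1 - D)) ≤ 2 * (x * ((x + 1) / (2 * x + 1) ^ 2)) := by gcongr
      have h2 : 2 * (x * ((x + 1) / (2 * x + 1) ^ 2)) ≤ 1 := by
        rw [← mul_div_assoc, ← mul_div_assoc, div_le_one (by positivity)]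
        nlinarith
      linarith
    have hE : x * (4 * r + 8 / x - D) = 4 * x * r + 8 - x * D := by field_simp
    rw [hE]
    have h1 : 3 / 2 * (x + 6) * (2 - 2 * r + 2 * r ^ 2)
        ≤ 3 / 2 * (x + 6) * (2 + 4 * r / x + 2 * r ^ 2 - 2 * r * D) := by
      gcongr
      linarith
    have h2 : 0 ≤ x * ((1 - r) * (4 - 3 * r)) :=
      mul_nonneg hx.le (mul_nonneg (by linarith) (by linarith))
    nlinarith [sq_nonneg (r - 1 / 2)]

/-- **High wavenumber refinement** (Lemma 2.2). -/
theorem high_wavenumber_refinement :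
    ∃ ct cn : ℝ, 0 < ct ∧ 0 < cn ∧ ∀ ε ∈ Set.Ioo (0:ℝ) 1, ∀ k : ℤ, k ≠ 0 →
      ct⁻¹ * (ε * |(k:ℝ)|) ≤ (mt ε k)⁻¹ ∧ (mt ε k)⁻¹ ≤ ct⁻¹ * (ε * |(k:ℝ)| + 1) ∧
      cn⁻¹ * (ε * |(k:ℝ)|) ≤ (mn ε k)⁻¹ ∧ (mn ε k)⁻¹ ≤ cn⁻¹ * (ε * |(k:ℝ)| + 1) := by
  refine ⟨(8 * Real.pi ^ 2)⁻¹, (6 * Real.pi ^ 2)⁻¹, by positivity, by positivity, ?_⟩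
  rintro ε ⟨hε, -⟩ k hk
  have hk' : 0 < |(k:ℝ)| := abs_pos.2 (by exact_mod_cast hk)
  have hpi := Real.pi_gt_three
  set y := ε * |(k:ℝ)| with hy
  obtain ⟨x, hxy⟩ : ∃ x, x = 2 * Real.pi * y := ⟨_, rfl⟩
  have hx : 0 < x := by rw [hxy]; positivity
  obtain ⟨r, hr⟩ : ∃ r, r = coshMoment 0 x / coshMoment 1 x := ⟨_, rfl⟩
  obtain ⟨D, hD⟩ : ∃ D, D = 2 * r + x * (r ^ 2 - 1) := ⟨_, rfl⟩
  obtain ⟨hlow, hup⟩ := coshMoment_ratio_bounds hx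
  rw [← hr] at hlow hup
  have hr0 : 0 < r := hr ▸ div_pos (coshMoment_pos 0 hx) (coshMoment_pos 1 hx)
  have hr1 : r ≤ 1 := hr ▸ (div_le_one (coshMoment_pos 1 hx)).2 (coshMoment_zero_le_one hx)
  have hDlow : x * (4 * x + 3) / (2 * x + 1) ^ 2 ≤ D := hD ▸ le_tangential_symbol hx hlow
  have hD1 : D ≤ 1 := by rw [hD]; linarith
  have hD0 : 0 < D := lt_of_lt_of_le (by positivity) hDlow
  obtain ⟨hn1, hn2⟩ := normal_symbol_bounds hx hr0 hr1 hlow hDlow hD1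
  rw [inv_inv, inv_inv, inv_mt_eq hε hk hxy hr, inv_mn_eq hε hk hxy hr hD, ← hD]
  have ht1 : x ≤ x / D := (le_div_iff₀ hD0).2 (mul_le_of_le_one_right hx.le hD1)
  have ht2 : x / D ≤ x + 1 := by
    rw [div_le_iff₀ hD0]
    refine le_trans ?_ (mul_le_mul_of_nonneg_left hDlow (by positivity))
    rw [← mul_div_assoc, le_div_iff₀ (by positivity)]
    nlinarith [mul_pos hx hx]
  refine ⟨?_, ?_, ?_, ?_⟩
  · calc 8 * Real.pi ^ 2 * y = 4 * Real.pi * x := by rw [hxy]; ring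
      _ ≤ _ := by gcongr
  · calc 4 * Real.pi * (x / D) ≤ 4 * Real.pi * (x + 2 * Real.pi) := by gcongr; linarith
      _ = _ := by rw [hxy]; ring
  · calc 6 * Real.pi ^ 2 * y = 2 * Real.pi * (3 / 2 * x) := by rw [hxy]; ring
      _ ≤ _ := by gcongr
  · refine (mul_le_mul_of_nonneg_left hn2 (by positivity)).trans ?_
    calc 2 * Real.pi * (3 / 2 * (x + 6)) ≤ 2 * Real.pi * (3 / 2 * (x + 2 * Real.pi)) := by
          gcongr; linarith
      _ = _ := by rw [hxy]; ring

end Filament
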